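/- Let n = 2m be even and σ = 2δ even, τ ∈ {0,1}. Define Q = V + span{p_{n−j}(x) q_{j+δ}(y) − (−1)^τ p_j(x) q_{n+δ−j}(y) : 0 ≤ j ≤ m−1+τ} with V as before. Then Q is a subspace of P_{n+δ}(x,y) of dimension M = δ(δ+1)/2 + m + τ all of whose elements vanish on S_τ, and since a set of Lagrange basis polynomials for S_τ exists in P_{n+δ}(x,y), every polynomial in P_{n+δ}(x,y) vanishing on all of S_τ lies in Q; hence the set of bivariate Lagrange basis polynomials for S_τ is unique in the quotient space P_{n+δ}(x,y)/Q. -/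

import Mathlib

open Polynomial Finset

/-- The fixed univariate node polynomial `(x-x_0)⋯(x-x_n)` viewed as a bivariate
polynomial in the first variable. -/
noncomputable def nodePoly (n : ℕ) (x : ℕ → ℝ) : MvPolynomial (Fin 2) ℝ :=
  ∏ i ∈ Finset.range (n+1), (MvPolynomial.X 0 - MvPolynomial.C (x i))

/-- The generators `(x-x_0)⋯(x-x_n) x^j y^k`, `j + k ≤ δ - 1`, of the subspace `V`. -/
noncomputable def Vgens (n δ : ℕ) (x : ℕ → ℝ) : Set (MvPolynomial (Fin 2) ℝ) :=
  {g | ∃ j k : ℕ, j + k < δ ∧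
    g = nodePoly n x * MvPolynomial.X 0 ^ j * MvPolynomial.X 1 ^ k}

/-- View a univariate real polynomial as a bivariate polynomial in variable `i`. -/
noncomputable def toMv2 (i : Fin 2) (f : Polynomial ℝ) : MvPolynomial (Fin 2) ℝ :=
  Polynomial.eval₂ MvPolynomial.C (MvPolynomial.X i) f

/-- The vanishing polynomial `p_{n-j}(x) q_{j+δ}(y) - (-1)^τ p_j(x) q_{n+δ-j}(y)`. -/
noncomputable def Fpoly (n δ τ : ℕ) (p q : ℕ → Polynomial ℝ) (j : ℕ) :
    MvPolynomial (Fin 2) ℝ :=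
  toMv2 0 (p (n - j)) * toMv2 1 (q (j + δ)) -
    MvPolynomial.C ((-1 : ℝ)^τ) * (toMv2 0 (p j) * toMv2 1 (q (n + δ - j)))

lemma toMv2_add (i : Fin 2) (f g : Polynomial ℝ) : toMv2 i (f + g) = toMv2 i f + toMv2 i g :=
  Polynomial.eval₂_add _ _

lemma toMv2_mul (i : Fin 2) (f g : Polynomial ℝ) : toMv2 i (f * g) = toMv2 i f * toMv2 i g :=
  Polynomial.eval₂_mul _ _

lemma toMv2_smul (i : Fin 2) (t : ℝ) (f : Polynomial ℝ) : toMv2 i (t • f) = t • toMv2 i f := by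
  rw [Polynomial.smul_eq_C_mul, toMv2_mul, MvPolynomial.smul_eq_C_mul]
  simp [toMv2]

/-- `toMv2` as a linear map. -/
noncomputable def toMv2L (i : Fin 2) : Polynomial ℝ →ₗ[ℝ] MvPolynomial (Fin 2) ℝ where
  toFun := toMv2 i
  map_add' := toMv2_add i
  map_smul' := toMv2_smul i

lemma toMv2_pow (i : Fin 2) (k : ℕ) : toMv2 i (X ^ k) = MvPolynomial.X i ^ k := by
  simp [toMv2]

lemma eval_toMv2 (v : Fin 2 → ℝ) (i : Fin 2) (f : Polynomial ℝ) :
    MvPolynomial.eval v (toMv2 i f) = f.eval (v i) := by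
  unfold toMv2
  rw [Polynomial.hom_eval₂]
  simp only [MvPolynomial.eval_X, Polynomial.eval]
  congr 1
  ext t
  simp

lemma totalDegree_toMv2 (i : Fin 2) (f : Polynomial ℝ) :
    (toMv2 i f).totalDegree ≤ f.natDegree := by
  unfold toMv2
  rw [Polynomial.eval₂_eq_sum_range]
  apply MvPolynomial.totalDegree_finsetSum_le
  intro k hk
  refine (MvPolynomial.totalDegree_mul _ _).trans ?_
  rw [MvPolynomial.totalDegree_C, MvPolynomial.totalDegree_X_pow]
  simp at hk; omega

/-- The univariate node polynomial. -/
noncomputable def wPoly (n : ℕ) (x : ℕ → ℝ) : Polynomial ℝ :=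
  ∏ i ∈ Finset.range (n+1), (X - C (x i))

lemma wPoly_monic (n : ℕ) (x : ℕ → ℝ) : (wPoly n x).Monic :=
  Polynomial.monic_prod_of_monic _ _ fun i _ => Polynomial.monic_X_sub_C (x i)

lemma wPoly_natDegree (n : ℕ) (x : ℕ → ℝ) : (wPoly n x).natDegree = n + 1 := by
  unfold wPoly
  rw [Polynomial.natDegree_prod_of_monic _ _ fun i _ => Polynomial.monic_X_sub_C (x i)]
  simp

lemma nodePoly_eq (n : ℕ) (x : ℕ → ℝ) : nodePoly n x = toMv2 0 (wPoly n x) := by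
  unfold nodePoly wPoly toMv2
  rw [Polynomial.eval₂_finsetProd]
  simp

lemma wPoly_eval (n : ℕ) (x : ℕ → ℝ) (r : ℕ) (hr : r ≤ n) : (wPoly n x).eval (x r) = 0 := by
  unfold wPoly
  rw [Polynomial.eval_prod]
  apply Finset.prod_eq_zero (i := r)
  · simp; omega
  · simp

lemma nodePoly_ne_zero (n : ℕ) (x : ℕ → ℝ) : nodePoly n x ≠ 0 := by
  unfold nodePoly
  rw [Finset.prod_ne_zero_iff]
  intro i _ h
  have := congrArg (MvPolynomial.eval ![x i + 1, 0]) h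
  simp at this

/-- degree-bounded polynomials lie in the span -/
lemma mem_span_seq (p : ℕ → Polynomial ℝ) (n : ℕ) (hp0 : p 0 = 1)
    (hpdeg : ∀ j, j ≤ n → (p j).natDegree = j) (d : ℕ) (hd : d ≤ n) :
    ∀ f : Polynomial ℝ, f.natDegree ≤ d → f ∈ Submodule.span ℝ (p '' Set.Iic d) := by
  induction d with
  | zero =>
    intro f hf
    rw [Polynomial.eq_C_of_natDegree_le_zero hf]
    have : (C (f.coeff 0) : Polynomial ℝ) = f.coeff 0 • p 0 := by
      rw [hp0, Polynomial.smul_eq_C_mul, mul_one]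
    rw [this]
    exact Submodule.smul_mem _ _ (Submodule.subset_span ⟨0, by simp, rfl⟩)
  | succ d ih =>
    intro f hf
    have hpd := hpdeg (d+1) hd
    have hl : (p (d+1)).coeff (d+1) ≠ 0 := by
      have h0 : p (d+1) ≠ 0 := by
        intro h; rw [h] at hpd; simp at hpd
      have := Polynomial.leadingCoeff_ne_zero.2 h0
      rwa [Polynomial.leadingCoeff, hpd] at this
    set t := f.coeff (d+1) / (p (d+1)).coeff (d+1) with ht
    have h1 : (f - t • p (d+1)).natDegree ≤ d := by
      rw [Polynomial.natDegree_le_iff_coeff_eq_zero]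
      intro N hN
      rcases Nat.lt_or_ge (d+1) N with h | h
      · rw [Polynomial.coeff_sub, Polynomial.coeff_smul,
          Polynomial.coeff_eq_zero_of_natDegree_lt (by omega),
          Polynomial.coeff_eq_zero_of_natDegree_lt (p := p (d+1)) (by omega)]
        simp
      · obtain rfl : N = d + 1 := by omega
        rw [Polynomial.coeff_sub, Polynomial.coeff_smul, ht, smul_eq_mul]
        field_simp
        ring
    have h2 := ih (by omega) _ h1
    have h3 : f = (f - t • p (d+1)) + t • p (d+1) := by ring
    rw [h3]
    refine Submodule.add_mem _ (Submodule.span_mono (Set.image_mono ?_) h2)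
      (Submodule.smul_mem _ _ (Submodule.subset_span ⟨d+1, by simp, rfl⟩))
    intro k hk; simp at hk ⊢; omega

lemma seq_indep (p : ℕ → Polynomial ℝ) (n : ℕ) (hp0 : p 0 = 1)
    (hpdeg : ∀ j, j ≤ n → (p j).natDegree = j) (c : ℕ → ℝ)
    (h : ∑ j ∈ Finset.range (n+1), c j • p j = 0) : ∀ j, j ≤ n → c j = 0 := by
  induction n with
  | zero =>
    intro j hj
    obtain rfl : j = 0 := by omega
    simpa [hp0] using h
  | succ n ih =>
    have hpd := hpdeg (n+1) le_rfl
    have hl : (p (n+1)).coeff (n+1) ≠ 0 := by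
      have h0 : p (n+1) ≠ 0 := by
        intro h; rw [h] at hpd; simp at hpd
      have := Polynomial.leadingCoeff_ne_zero.2 h0
      rwa [Polynomial.leadingCoeff, hpd] at this
    have hc : c (n+1) = 0 := by
      have h2 := congrArg (fun f => Polynomial.coeff f (n+1)) h
      simp only [Polynomial.finsetSum_coeff, Polynomial.coeff_smul, Polynomial.coeff_zero] at h2
      rw [Finset.sum_range_succ, Finset.sum_eq_zero] at h2
      · simpa [hl] using h2
      · intro j hj
        simp at hj
        rw [Polynomial.coeff_eq_zero_of_natDegree_lt]
        · simp
        · rw [hpdeg j (by omega)]; omega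
    rw [Finset.sum_range_succ, hc, zero_smul, add_zero] at h
    have := ih (fun j hj => hpdeg j (by omega)) h
    intro j hj
    rcases Nat.lt_or_ge n j with h' | h'
    · obtain rfl : j = n+1 := by omega
      exact hc
    · exact this j h'

lemma node_inj (n : ℕ) (x : ℕ → ℝ) (hx : ∀ j, j < n → x (j+1) < x j) :
    Set.InjOn x (Finset.range (n+1)) := by
  have key : ∀ i k, i + k + 1 ≤ n → x (i + k + 1) < x i := by
    intro i k
    induction k with
    | zero => intro h; exact hx i (by omega)
    | succ k ih => intro h; exact (hx (i+k+1) (by omega)).trans (ih (by omega))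
  intro i hi j hj hij
  simp at hi hj
  rcases Nat.lt_trichotomy i j with h | h | h
  · obtain ⟨k, rfl⟩ := Nat.exists_eq_add_of_lt h
    have := key i k (by omega); linarith
  · exact h
  · obtain ⟨k, rfl⟩ := Nat.exists_eq_add_of_lt h
    have := key j k (by omega); linarith

lemma seq_indep_nodes (p : ℕ → Polynomial ℝ) (n : ℕ) (hp0 : p 0 = 1)
    (hpdeg : ∀ j, j ≤ n → (p j).natDegree = j)
    (x : ℕ → ℝ) (hx : ∀ j, j < n → x (j+1) < x j) (c : ℕ → ℝ)
    (h : ∀ r, r ≤ n → ∑ j ∈ Finset.range (n+1), c j * (p j).eval (x r) = 0) :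
    ∀ j, j ≤ n → c j = 0 := by
  apply seq_indep p n hp0 hpdeg c
  have hinj := node_inj n x hx
  apply Polynomial.eq_zero_of_natDegree_lt_card_of_eval_eq_zero' _ ((Finset.range (n+1)).image x)
  · intro z hz
    simp only [Finset.mem_image, Finset.mem_range] at hz
    obtain ⟨r, hr, rfl⟩ := hz
    rw [Polynomial.eval_finsetSum]
    simpa using h r (by omega)
  · rw [Finset.card_image_of_injOn hinj, Finset.card_range, Nat.lt_succ_iff]
    apply Polynomial.natDegree_sum_le_of_forall_le
    intro j hj
    simp at hj
    exact (Polynomial.natDegree_smul_le _ _).trans (by rw [hpdeg j (by omega)]; omega)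

lemma grid_indep (p q : ℕ → Polynomial ℝ) (n N : ℕ) (hp0 : p 0 = 1) (hq0 : q 0 = 1)
    (hpdeg : ∀ j, j ≤ n → (p j).natDegree = j)
    (hqdeg : ∀ j, j ≤ N → (q j).natDegree = j)
    (x y : ℕ → ℝ) (hx : ∀ j, j < n → x (j+1) < x j) (hy : ∀ j, j < N → y (j+1) < y j)
    (c : ℕ → ℕ → ℝ)
    (h : ∀ r u, r ≤ n → u ≤ N → ∑ j ∈ Finset.range (n+1), ∑ k ∈ Finset.range (N+1),
      c j k * ((p j).eval (x r) * (q k).eval (y u)) = 0) :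
    ∀ j k, j ≤ n → k ≤ N → c j k = 0 := by
  intro j k hj hk
  refine seq_indep_nodes q N hq0 hqdeg y hy (fun k => c j k) ?_ k hk
  intro u hu
  refine seq_indep_nodes p n hp0 hpdeg x hx
    (fun j => ∑ k ∈ Finset.range (N+1), c j k * (q k).eval (y u)) ?_ j hj
  intro r hr
  rw [← h r u hr hu]
  refine Finset.sum_congr rfl fun j _ => ?_
  rw [Finset.sum_mul]
  refine Finset.sum_congr rfl fun k _ => ?_
  ring

/-- The products `p_j(x) q_k(y)` -/
noncomputable def Gp (p q : ℕ → Polynomial ℝ) (j k : ℕ) : MvPolynomial (Fin 2) ℝ :=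
  toMv2 0 (p j) * toMv2 1 (q k)

lemma eval_Gp (p q : ℕ → Polynomial ℝ) (j k : ℕ) (s t : ℝ) :
    MvPolynomial.eval ![s, t] (Gp p q j k) = (p j).eval s * (q k).eval t := by
  simp [Gp, eval_toMv2]

lemma Fpoly_eq (n δ τ : ℕ) (p q : ℕ → Polynomial ℝ) (j : ℕ) (hj : j ≤ n) :
    Fpoly n δ τ p q j = Gp p q (n-j) (n+δ-(n-j)) - ((-1:ℝ)^τ) • Gp p q j (n+δ-j) := by
  unfold Fpoly Gp
  rw [MvPolynomial.smul_eq_C_mul, show n + δ - (n-j) = j + δ by omega]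

lemma sumprod_mem (p q : ℕ → Polynomial ℝ) (A B : ℕ) (f g : Polynomial ℝ)
    (hf : f ∈ Submodule.span ℝ (p '' Set.Iic A)) (hg : g ∈ Submodule.span ℝ (q '' Set.Iic B))
    (W : Submodule ℝ (MvPolynomial (Fin 2) ℝ)) (hW : ∀ j k, j ≤ A → k ≤ B → Gp p q j k ∈ W) :
    toMv2 0 f * toMv2 1 g ∈ W := by
  let M : Submodule ℝ (Polynomial ℝ) :=
    { carrier := {f | ∀ k ≤ B, toMv2 0 f * toMv2 1 (q k) ∈ W}
      add_mem' := by
        intro a b ha hb k hk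
        rw [toMv2_add, add_mul]; exact W.add_mem (ha k hk) (hb k hk)
      zero_mem' := by intro k hk; simp [toMv2]
      smul_mem' := by
        intro t a ha k hk
        rw [toMv2_smul, smul_mul_assoc]; exact W.smul_mem _ (ha k hk) }
  have hfM : f ∈ M := by
    refine (Submodule.span_le.2 ?_) hf
    rintro _ ⟨j, hj, rfl⟩ k hk
    exact hW j k hj hk
  let M2 : Submodule ℝ (Polynomial ℝ) :=
    { carrier := {g | toMv2 0 f * toMv2 1 g ∈ W}
      add_mem' := by
        intro a b ha hb
        simp only [Set.mem_ofPred_eq] at *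
        rw [toMv2_add, mul_add]; exact W.add_mem ha hb
      zero_mem' := by simp [toMv2]
      smul_mem' := by
        intro t a ha
        simp only [Set.mem_ofPred_eq] at *
        rw [toMv2_smul, mul_smul_comm]; exact W.smul_mem _ ha }
  have : g ∈ M2 := by
    refine (Submodule.span_le.2 ?_) hg
    rintro _ ⟨k, hk, rfl⟩
    exact hfM k hk
  exact this

lemma monom_mem (p q : ℕ → Polynomial ℝ) (n δ : ℕ) (hp0 : p 0 = 1) (hq0 : q 0 = 1)
    (hpdeg : ∀ j, j ≤ n → (p j).natDegree = j)
    (hqdeg : ∀ j, j ≤ n + 2 * δ → (q j).natDegree = j) (x : ℕ → ℝ)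
    (W : Submodule ℝ (MvPolynomial (Fin 2) ℝ)) (hV : Vgens n δ x ⊆ W)
    (hW : ∀ j k, j ≤ n → j + k ≤ n + δ → Gp p q j k ∈ W) (a b : ℕ) (hab : a + b ≤ n + δ) :
    MvPolynomial.X 0 ^ a * MvPolynomial.X 1 ^ b ∈ W := by
  have hw := wPoly_monic n x
  have hdec := Polynomial.modByMonic_add_div (X ^ a) (wPoly n x)
  set s := (X ^ a) %ₘ (wPoly n x) with hs
  set t := (X ^ a) /ₘ (wPoly n x) with ht
  have hs1 : s.natDegree ≤ min a n := by
    apply le_min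
    · have := Polynomial.natDegree_modByMonic_le_left (p := (X : Polynomial ℝ) ^ a) (q := wPoly n x)
      simpa using this
    · have := Polynomial.natDegree_modByMonic_lt (X ^ a) hw (by
        intro h; have := wPoly_natDegree n x; rw [h] at this; simp at this)
      rw [wPoly_natDegree] at this
      exact Nat.lt_succ_iff.1 this
  rw [← toMv2_pow, ← toMv2_pow, ← hdec, toMv2_add, add_mul]
  refine W.add_mem ?_ ?_
  · refine sumprod_mem p q (min a n) b _ _
      (mem_span_seq p n hp0 hpdeg _ (min_le_right _ _) _ hs1)
      (mem_span_seq q (n+2*δ) hq0 hqdeg _ (by omega) _ (by simp)) W ?_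
    intro j k hj hk
    exact hW j k (by omega) (by omega)
  · have htd : t.natDegree = a - (n+1) := by
      rw [ht, Polynomial.natDegree_divByMonic _ hw, wPoly_natDegree]; simp
    by_cases ha : a ≤ n
    · have : t = 0 := by
        rw [ht, Polynomial.divByMonic_eq_zero_iff hw, Polynomial.degree_X_pow,
          Polynomial.degree_eq_natDegree hw.ne_zero, wPoly_natDegree]
        exact_mod_cast Nat.lt_succ_of_le ha
      rw [this]; simp [toMv2]
    · rw [toMv2_mul, ← nodePoly_eq, toMv2_pow]
      have : toMv2 0 t = ∑ j ∈ Finset.range (t.natDegree + 1),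
          t.coeff j • (MvPolynomial.X 0 ^ j : MvPolynomial (Fin 2) ℝ) := by
        unfold toMv2
        rw [Polynomial.eval₂_eq_sum_range]
        simp [MvPolynomial.smul_eq_C_mul]
      rw [this, Finset.mul_sum, Finset.sum_mul]
      refine W.sum_mem fun j hj => ?_
      simp at hj
      rw [mul_smul_comm, smul_mul_assoc]
      exact W.smul_mem _ (hV ⟨j, b, by omega, rfl⟩)

lemma poly_mem (p q : ℕ → Polynomial ℝ) (n δ : ℕ) (hp0 : p 0 = 1) (hq0 : q 0 = 1)
    (hpdeg : ∀ j, j ≤ n → (p j).natDegree = j)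
    (hqdeg : ∀ j, j ≤ n + 2 * δ → (q j).natDegree = j) (x : ℕ → ℝ)
    (W : Submodule ℝ (MvPolynomial (Fin 2) ℝ)) (hV : Vgens n δ x ⊆ W)
    (hW : ∀ j k, j ≤ n → j + k ≤ n + δ → Gp p q j k ∈ W) (P : MvPolynomial (Fin 2) ℝ)
    (hP : P.totalDegree ≤ n + δ) : P ∈ W := by
  rw [← P.support_sum_monomial_coeff]
  refine W.sum_mem fun s hs => ?_
  have h1 := (MvPolynomial.le_totalDegree hs).trans hP
  rw [Finsupp.sum_fintype _ _ (by simp), Fin.sum_univ_two] at h1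
  rw [MvPolynomial.monomial_eq, Finsupp.prod_fintype _ _ (by simp), Fin.prod_univ_two,
    ← MvPolynomial.smul_eq_C_mul]
  exact W.smul_mem _ (monom_mem p q n δ hp0 hq0 hpdeg hqdeg x W hV hW _ _ h1)

lemma eval_Vspan (n δ : ℕ) (x : ℕ → ℝ) (P : MvPolynomial (Fin 2) ℝ)
    (hP : P ∈ Submodule.span ℝ (Vgens n δ x)) (r : ℕ) (hr : r ≤ n) (t : ℝ) :
    MvPolynomial.eval ![x r, t] P = 0 := by
  induction hP using Submodule.span_induction with
  | mem g hg =>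
    obtain ⟨j, k, _, rfl⟩ := hg
    simp [nodePoly_eq, eval_toMv2, wPoly_eval n x r hr]
  | zero => simp
  | add a b _ _ ha hb => simp [ha, hb]
  | smul t a _ ha => simp [MvPolynomial.smul_eq_C_mul, ha]

/-- Elements of `Q` from antisymmetric coefficients. -/
lemma anti_mem (n m δ τ : ℕ) (hn : n = 2 * m) (hτ : τ ≤ 1) (p q : ℕ → Polynomial ℝ)
    (W : Submodule ℝ (MvPolynomial (Fin 2) ℝ)) (hW : ∀ j < m + τ, Fpoly n δ τ p q j ∈ W)
    (e : ℕ → ℝ) (he : ∀ j, j ≤ n → e j + (-1)^τ * e (n - j) = 0) :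
    ∑ j ∈ Finset.range (n+1), e j • Gp p q j (n+δ-j) ∈ W := by
  have hs2 : ((-1:ℝ)^τ) * (-1)^τ = 1 := by rw [← mul_pow]; norm_num
  have hF : ∀ j, j ≤ n → Fpoly n δ τ p q j ∈ W := by
    intro j hj
    by_cases h1 : j < m + τ
    · exact hW j h1
    by_cases h2 : n - j < m + τ
    · have := hW _ h2
      rw [Fpoly_eq _ _ _ _ _ _ (by omega), show n - (n-j) = j by omega] at this
      have h3 := W.smul_mem (-(-1:ℝ)^τ) this
      rw [smul_sub, smul_smul, neg_mul, hs2] at h3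
      rw [Fpoly_eq _ _ _ _ _ _ hj]
      convert h3 using 1
      module
    · have h3 : τ = 0 := by omega
      have h4 : n - j = j := by omega
      rw [Fpoly_eq _ _ _ _ _ _ hj, h4, h3]; simp
  have key : ∑ j ∈ Finset.range (n+1), e j • Gp p q j (n+δ-j)
      = (1/2:ℝ) • ∑ j ∈ Finset.range (n+1), e (n-j) • Fpoly n δ τ p q j := by
    have hr := Finset.sum_range_reflect (fun j => e j • Gp p q j (n+δ-j)) (n+1)
    simp only [Nat.add_sub_cancel] at hr
    have : ∑ j ∈ Finset.range (n+1), e (n-j) • Fpoly n δ τ p q j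
        = ∑ j ∈ Finset.range (n+1), e (n-j) • Gp p q (n-j) (n+δ-(n-j))
          + ∑ j ∈ Finset.range (n+1), e j • Gp p q j (n+δ-j) := by
      rw [← Finset.sum_add_distrib]
      refine Finset.sum_congr rfl fun j hj => ?_
      have hj' : j ≤ n := by simp at hj; omega
      rw [Fpoly_eq _ _ _ _ _ _ hj']
      have : e j = -((-1)^τ * e (n-j)) := by linarith [he j hj']
      rw [this]
      module
    rw [this, hr]
    module
  rw [key]
  refine W.smul_mem _ (W.sum_mem fun j hj => W.smul_mem _ (hF j ?_))
  simp at hj; omega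

lemma diag_sum (n N δ : ℕ) (hN : n + δ ≤ N) (e : ℕ → ℝ) (f : ℕ → ℕ → ℝ) :
    ∑ j ∈ Finset.range (n+1), ∑ k ∈ Finset.range (N+1),
      (if k = n + δ - j then e j else 0) * f j k
    = ∑ j ∈ Finset.range (n+1), e j * f j (n+δ-j) := by
  refine Finset.sum_congr rfl fun j hj => ?_
  rw [Finset.sum_eq_single (n+δ-j)]
  · simp
  · intro k _ hk; simp [hk]
  · intro h; simp at h; omega

/-- if a combination of the `F_j` vanishes on the grid, the coefficients vanish -/
lemma F_indep (n m δ τ : ℕ) (hn : n = 2 * m) (hm : 1 ≤ m) (hτ : τ ≤ 1)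
    (x y : ℕ → ℝ) (p q : ℕ → Polynomial ℝ)
    (hx : ∀ j, j < n → x (j+1) < x j)
    (hy : ∀ j, j < n + 2 * δ → y (j+1) < y j)
    (hp0 : p 0 = 1) (hq0 : q 0 = 1)
    (hpdeg : ∀ j, j ≤ n → (p j).natDegree = j)
    (hqdeg : ∀ k, k ≤ n + 2 * δ → (q k).natDegree = k)
    (α : ℕ → ℝ) (hα : ∀ j, m + τ ≤ j → α j = 0)
    (h : ∀ r u, r ≤ n → u ≤ n + 2 * δ → MvPolynomial.eval ![x r, y u]
      (∑ j ∈ Finset.range (m+τ), α j • Fpoly n δ τ p q j) = 0) :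
    ∀ j, α j = 0 := by
  have hsum : ∑ j ∈ Finset.range (m+τ), α j • Fpoly n δ τ p q j
      = ∑ j ∈ Finset.range (n+1), (α (n-j) - (-1)^τ * α j) • Gp p q j (n+δ-j) := by
    have h1 : ∑ j ∈ Finset.range (m+τ), α j • Fpoly n δ τ p q j
        = ∑ j ∈ Finset.range (n+1), α j • Fpoly n δ τ p q j := by
      apply Finset.sum_subset
      · intro j hj; simp at hj ⊢; omega
      · intro j _ hj; simp at hj; rw [hα j hj, zero_smul]
    have hr := Finset.sum_range_reflect (fun j => α (n-j) • Gp p q j (n+δ-j)) (n+1)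
    simp only [Nat.add_sub_cancel] at hr
    have h2 : ∀ j ∈ Finset.range (n+1), (α (n-j) - (-1)^τ * α j) • Gp p q j (n+δ-j)
        = α (n-j) • Gp p q j (n+δ-j) - ((-1)^τ * α j) • Gp p q j (n+δ-j) :=
      fun j _ => sub_smul _ _ _
    rw [h1, Finset.sum_congr rfl h2, Finset.sum_sub_distrib, ← hr, ← Finset.sum_sub_distrib]
    refine Finset.sum_congr rfl fun j hj => ?_
    have hj' : j ≤ n := by simp at hj; omega
    rw [Fpoly_eq _ _ _ _ _ _ hj', show n - (n-j) = j by omega]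
    module
  rw [hsum] at h
  have hg := grid_indep p q n (n+2*δ) hp0 hq0 hpdeg hqdeg x y hx hy
    (fun j k => if k = n+δ-j then (α (n-j) - (-1)^τ * α j) else 0) (by
      intro r u hr hu
      rw [diag_sum n (n+2*δ) δ (by omega) (fun j => α (n-j) - (-1)^τ * α j)
        (fun j k => (p j).eval (x r) * (q k).eval (y u)), ← h r u hr hu, map_sum]
      refine Finset.sum_congr rfl fun j _ => ?_
      rw [MvPolynomial.smul_eval, eval_Gp])
  intro j
  by_cases hj : m + τ ≤ j
  · exact hα j hj
  have h3 := hg j (n+δ-j) (by omega) (by omega)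
  simp only [if_true] at h3
  by_cases hjm : j < m
  · rw [hα (n-j) (by omega)] at h3
    simpa using h3
  · have h5 : τ = 1 := by omega
    rw [show n - j = j by omega, h5] at h3
    linarith

/-- monomial exponent with prescribed values -/
noncomputable def expo (j k : ℕ) : Fin 2 →₀ ℕ := Finsupp.single 0 j + Finsupp.single 1 k

lemma V_indep (n δ : ℕ) (x : ℕ → ℝ) :
    LinearIndependent ℝ (fun i : (Σ d : Fin δ, Fin (d.1+1)) =>
      nodePoly n x * MvPolynomial.X 0 ^ i.2.1 * MvPolynomial.X 1 ^ (i.1.1 - i.2.1)) := by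
  have h1 : LinearIndependent ℝ (fun i : (Σ d : Fin δ, Fin (d.1+1)) =>
      (MvPolynomial.basisMonomials (Fin 2) ℝ) (expo i.2.1 (i.1.1 - i.2.1))) := by
    apply (MvPolynomial.basisMonomials (Fin 2) ℝ).linearIndependent.comp
    rintro ⟨⟨d, hd⟩, ⟨i, hi⟩⟩ ⟨⟨d', hd'⟩, ⟨i', hi'⟩⟩ h
    have ha := DFunLike.congr_fun h 0
    have hb := DFunLike.congr_fun h 1
    simp [expo] at ha hb hi hi'
    obtain rfl : d = d' := by omega
    subst ha
    rfl
  have h2 := h1.map' (LinearMap.mulLeft ℝ (nodePoly n x))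
    (LinearMap.ker_eq_bot.2 (mul_right_injective₀ (nodePoly_ne_zero n x)))
  have e : (fun i : (Σ d : Fin δ, Fin (d.1+1)) =>
      nodePoly n x * MvPolynomial.X 0 ^ i.2.1 * MvPolynomial.X 1 ^ (i.1.1 - i.2.1))
      = (LinearMap.mulLeft ℝ (nodePoly n x)) ∘ fun i : (Σ d : Fin δ, Fin (d.1+1)) =>
        (MvPolynomial.basisMonomials (Fin 2) ℝ) (expo i.2.1 (i.1.1 - i.2.1)) := by
    funext i
    simp [expo, MvPolynomial.X_pow_eq_monomial, mul_assoc, MvPolynomial.monomial_mul]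
  rw [e]
  exact h2

lemma V_range (n δ : ℕ) (x : ℕ → ℝ) :
    Set.range (fun i : (Σ d : Fin δ, Fin (d.1+1)) =>
      nodePoly n x * MvPolynomial.X 0 ^ i.2.1 * MvPolynomial.X 1 ^ (i.1.1 - i.2.1))
    = Vgens n δ x := by
  ext g
  constructor
  · rintro ⟨⟨⟨d, hd⟩, ⟨i, hi⟩⟩, rfl⟩
    exact ⟨i, d - i, by simp at hi; omega, rfl⟩
  · rintro ⟨j, k, hjk, rfl⟩
    refine ⟨⟨⟨j+k, hjk⟩, ⟨j, by simp⟩⟩, ?_⟩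
    simp

lemma dim_Q (n m δ τ : ℕ) (hn : n = 2 * m) (hm : 1 ≤ m) (hτ : τ ≤ 1)
    (x y : ℕ → ℝ) (p q : ℕ → Polynomial ℝ)
    (hx : ∀ j, j < n → x (j+1) < x j)
    (hy : ∀ j, j < n + 2 * δ → y (j+1) < y j)
    (hp0 : p 0 = 1) (hq0 : q 0 = 1)
    (hpdeg : ∀ j, j ≤ n → (p j).natDegree = j)
    (hqdeg : ∀ k, k ≤ n + 2 * δ → (q k).natDegree = k) :
    Module.finrank ℝ (Submodule.span ℝ
        (Vgens n δ x ∪ {g | ∃ j < m + τ, g = Fpoly n δ τ p q j}))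
      = δ * (δ + 1) / 2 + m + τ := by
  let fF : Fin (m+τ) → MvPolynomial (Fin 2) ℝ := fun j => Fpoly n δ τ p q j
  have hFr : Set.range fF = {g | ∃ j < m + τ, g = Fpoly n δ τ p q j} := by
    ext g
    constructor
    · rintro ⟨j, rfl⟩; exact ⟨j, j.2, rfl⟩
    · rintro ⟨j, hj, rfl⟩; exact ⟨⟨j, hj⟩, rfl⟩
  have hFkey : ∀ β : Fin (m+τ) → ℝ, (∀ r u, r ≤ n → u ≤ n + 2 * δ →
      MvPolynomial.eval ![x r, y u] (∑ j, β j • fF j) = 0) → ∀ j, β j = 0 := by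
    intro β hβ j
    have := F_indep n m δ τ hn hm hτ x y p q hx hy hp0 hq0 hpdeg hqdeg
      (fun j => if h : j < m + τ then β ⟨j, h⟩ else 0)
      (by intro j hj; simp [Nat.not_lt.2 hj]) (by
        intro r u hr hu
        rw [← hβ r u hr hu, Finset.sum_range]
        simp [fF]) j
    simpa using this
  have hFi : LinearIndependent ℝ fF := by
    rw [Fintype.linearIndependent_iff]
    intro β hβ
    exact hFkey β (by intro r u _ _; rw [hβ]; simp)
  have hdis : Disjoint (Submodule.span ℝ (Set.range (fun i : (Σ d : Fin δ, Fin (d.1+1)) =>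
      nodePoly n x * MvPolynomial.X 0 ^ i.2.1 * MvPolynomial.X 1 ^ (i.1.1 - i.2.1))))
      (Submodule.span ℝ (Set.range fF)) := by
    rw [V_range, Submodule.disjoint_def]
    intro z hz hz2
    rw [Submodule.mem_span_range_iff_exists_fun] at hz2
    obtain ⟨β, rfl⟩ := hz2
    have := hFkey β fun r u hr _ => eval_Vspan n δ x _ hz r hr _
    simp [this]
  have hind := (V_indep n δ x).sum_type hFi hdis
  have := finrank_span_eq_card hind
  rw [Set.Sum.elim_range, V_range, hFr] at this
  rw [this]
  simp only [Fintype.card_sum, Fintype.card_sigma, Fintype.card_fin]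
  rw [Fin.sum_univ_eq_sum_range (fun i => i + 1) δ]
  have hg : ∑ i ∈ Finset.range δ, (i+1) = δ * (δ+1) / 2 := by
    have h := Finset.sum_range_id (δ+1)
    rw [Finset.sum_range_succ'] at h
    simpa [mul_comm] using h
  rw [hg]; omega

lemma eval_Fpoly (n δ τ : ℕ) (x y : ℕ → ℝ) (p q : ℕ → Polynomial ℝ)
    (hxalt : ∀ j r, j ≤ n → r ≤ n →
      (p (n - j)).eval (x r) = (-1)^r * (p j).eval (x r))
    (hyalt : ∀ k u, k ≤ n + 2 * δ → u ≤ n + 2 * δ →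
      (q (n + 2 * δ - k)).eval (y u) = (-1)^u * (q k).eval (y u))
    (j : ℕ) (hj : j ≤ n) (r u : ℕ) (hr : r ≤ n) (hu : u ≤ n + 2 * δ) (hru : (r + u) % 2 = τ) :
    MvPolynomial.eval ![x r, y u] (Fpoly n δ τ p q j) = 0 := by
  have h1 := hxalt j r hj hr
  have h2 := hyalt (j+δ) u (by omega) hu
  rw [show n + 2 * δ - (j+δ) = n + δ - j by omega] at h2
  have h3 : (-1:ℝ)^τ * (-1)^u = (-1)^r := by
    rw [← hru, ← neg_one_pow_eq_pow_mod_two, ← pow_add, show r + u + u = r + 2 * u by ring,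
      pow_add, pow_mul]
    simp
  simp only [Fpoly, map_sub, map_mul, eval_toMv2, MvPolynomial.eval_C]
  simp only [Matrix.cons_val_zero, Matrix.cons_val_one]
  rw [h1, h2, ← h3]
  ring

lemma kernel_mem (n m δ τ : ℕ) (hn : n = 2 * m) (hτ : τ ≤ 1)
    (x y : ℕ → ℝ) (p q : ℕ → Polynomial ℝ)
    (hx : ∀ j, j < n → x (j+1) < x j)
    (hy : ∀ j, j < n + 2 * δ → y (j+1) < y j)
    (hp0 : p 0 = 1) (hq0 : q 0 = 1)
    (hpdeg : ∀ j, j ≤ n → (p j).natDegree = j)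
    (hqdeg : ∀ k, k ≤ n + 2 * δ → (q k).natDegree = k)
    (hxalt : ∀ j r, j ≤ n → r ≤ n →
      (p (n - j)).eval (x r) = (-1)^r * (p j).eval (x r))
    (hyalt : ∀ k u, k ≤ n + 2 * δ → u ≤ n + 2 * δ →
      (q (n + 2 * δ - k)).eval (y u) = (-1)^u * (q k).eval (y u))
    (P : MvPolynomial (Fin 2) ℝ) (hP : P.totalDegree ≤ n + δ)
    (hv : ∀ r u, r ≤ n → u ≤ n + 2 * δ → (r + u) % 2 = τ →
        MvPolynomial.eval ![x r, y u] P = 0) :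
    P ∈ Submodule.span ℝ (Vgens n δ x ∪ {g | ∃ j < m + τ, g = Fpoly n δ τ p q j}) := by
  -- the span of the products, in coefficient form
  let W2 : Submodule ℝ (MvPolynomial (Fin 2) ℝ) :=
    { carrier := {g | ∃ c : ℕ → ℕ → ℝ, (∀ j k, n + δ < j + k → c j k = 0) ∧
        g = ∑ j ∈ Finset.range (n+1), ∑ k ∈ Finset.range (n+2*δ+1), c j k • Gp p q j k}
      add_mem' := by
        rintro _ _ ⟨c, hc, rfl⟩ ⟨c', hc', rfl⟩
        refine ⟨fun j k => c j k + c' j k, fun j k h => by simp [hc j k h, hc' j k h], ?_⟩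
        simp only [add_smul, Finset.sum_add_distrib]
      zero_mem' := ⟨fun _ _ => 0, fun _ _ _ => rfl, by simp⟩
      smul_mem' := by
        rintro t _ ⟨c, hc, rfl⟩
        refine ⟨fun j k => t * c j k, fun j k h => by simp [hc j k h], ?_⟩
        simp only [Finset.smul_sum, smul_smul] }
  have hmem : P ∈ Submodule.span ℝ (Vgens n δ x) ⊔ W2 := by
    refine poly_mem p q n δ hp0 hq0 hpdeg hqdeg x _ ?_ ?_ P hP
    · intro g hg
      exact Submodule.mem_sup_left (Submodule.subset_span hg)
    · intro j k hj hjk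
      refine Submodule.mem_sup_right ⟨fun j' k' => if j' = j ∧ k' = k then 1 else 0, ?_, ?_⟩
      · intro j' k' h
        apply if_neg; rintro ⟨rfl, rfl⟩; omega
      · rw [Finset.sum_eq_single j, Finset.sum_eq_single k]
        · simp
        · intro b _ hb; simp [hb]
        · intro h; simp at h; omega
        · intro b _ hb; simp [hb]
        · intro h; simp at h; omega
  obtain ⟨v, hvV, g, ⟨c, hc, hg⟩, rfl⟩ := Submodule.mem_sup.1 hmem
  have hgv : ∀ r u, r ≤ n → u ≤ n + 2 * δ → (r + u) % 2 = τ →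
      ∑ j ∈ Finset.range (n+1), ∑ k ∈ Finset.range (n+2*δ+1),
        c j k * ((p j).eval (x r) * (q k).eval (y u)) = 0 := by
    intro r u hr hu hru
    have := hv r u hr hu hru
    rw [map_add, eval_Vspan n δ x v hvV r hr, zero_add, hg] at this
    simpa [map_sum, MvPolynomial.smul_eval, eval_Gp] using this
  have hrel := grid_indep p q n (n+2*δ) hp0 hq0 hpdeg hqdeg x y hx hy
    (fun j k => c j k + (-1)^τ * c (n-j) (n+2*δ-k)) (by
      intro r u hr hu
      have hrefl : ∑ j ∈ Finset.range (n+1), ∑ k ∈ Finset.range (n+2*δ+1),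
          c (n-j) (n+2*δ-k) * ((p j).eval (x r) * (q k).eval (y u))
          = (-1)^(r+u) * ∑ j ∈ Finset.range (n+1), ∑ k ∈ Finset.range (n+2*δ+1),
          c j k * ((p j).eval (x r) * (q k).eval (y u)) := by
        rw [← Finset.sum_range_reflect, Finset.mul_sum]
        refine Finset.sum_congr rfl fun j hj => ?_
        rw [← Finset.sum_range_reflect, Finset.mul_sum]
        refine Finset.sum_congr rfl fun k hk => ?_
        have hj' : j ≤ n := by simp at hj; omega
        have hk' : k ≤ n + 2 * δ := by simp at hk; omega
        simp only [Nat.add_sub_cancel]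
        rw [hxalt j r hj' hr, hyalt k u hk' hu, show n - (n-j) = j by omega,
          show n + 2*δ - (n+2*δ-k) = k by omega, pow_add]
        ring
      simp only [add_mul, Finset.sum_add_distrib, mul_assoc, ← Finset.mul_sum]
      rw [hrefl]
      by_cases hru : (r + u) % 2 = τ
      · rw [hgv r u hr hu hru]; simp
      · have h3 : (-1:ℝ)^τ * (-1)^(r+u) = -1 := by
          rw [← pow_add]
          apply Odd.neg_one_pow
          rw [Nat.odd_iff]; omega
        rw [← mul_assoc, h3]; ring)
  have hc0 : ∀ j k, j ≤ n → k ≤ n + 2 * δ → k ≠ n + δ - j → c j k = 0 := by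
    intro j k hj hk hne
    rcases Nat.lt_or_ge (n+δ) (j+k) with h | h
    · exact hc j k h
    · have := hrel j k hj hk
      rw [hc (n-j) (n+2*δ-k) (by omega)] at this
      simpa using this
  have hg2 : g = ∑ j ∈ Finset.range (n+1), c j (n+δ-j) • Gp p q j (n+δ-j) := by
    rw [hg]
    refine Finset.sum_congr rfl fun j hj => ?_
    simp at hj
    rw [Finset.sum_eq_single (n+δ-j)]
    · intro k hk hne
      simp at hk
      rw [hc0 j k (by omega) (by omega) hne, zero_smul]
    · intro h; simp at h; omega
  refine Submodule.add_mem _ (Submodule.span_mono Set.subset_union_left hvV) ?_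
  rw [hg2]
  refine anti_mem n m δ τ hn hτ p q _ ?_ (fun j => c j (n+δ-j)) ?_
  · intro j hj
    exact Submodule.subset_span (Or.inr ⟨j, hj, rfl⟩)
  · intro j hj
    have := hrel j (n+δ-j) hj (by omega)
    simpa only [show n + 2*δ - (n+δ-j) = n + δ - (n-j) by omega] using this

lemma deg_Q (n m δ τ : ℕ) (hn : n = 2 * m) (hm : 1 ≤ m) (hτ : τ ≤ 1)
    (x : ℕ → ℝ) (p q : ℕ → Polynomial ℝ)
    (hpdeg : ∀ j, j ≤ n → (p j).natDegree = j)
    (hqdeg : ∀ k, k ≤ n + 2 * δ → (q k).natDegree = k)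
    (P : MvPolynomial (Fin 2) ℝ) (hP : P ∈ Submodule.span ℝ
      (Vgens n δ x ∪ {g | ∃ j < m + τ, g = Fpoly n δ τ p q j})) :
    P.totalDegree ≤ n + δ := by
  rw [← MvPolynomial.mem_restrictTotalDegree]
  refine (Submodule.span_le.2 ?_) hP
  have hG : ∀ j, j ≤ n → Gp p q j (n+δ-j) ∈ MvPolynomial.restrictTotalDegree (Fin 2) ℝ (n+δ) := by
    intro j hj
    rw [MvPolynomial.mem_restrictTotalDegree]
    refine (MvPolynomial.totalDegree_mul _ _).trans ?_
    have h1 := totalDegree_toMv2 0 (p j)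
    have h2 := totalDegree_toMv2 1 (q (n+δ-j))
    rw [hpdeg j hj] at h1
    rw [hqdeg _ (by omega)] at h2
    omega
  rintro g (⟨j, k, hjk, rfl⟩ | ⟨j, hj, rfl⟩)
  · rw [SetLike.mem_coe, MvPolynomial.mem_restrictTotalDegree]
    refine (MvPolynomial.totalDegree_mul _ _).trans ?_
    have h0 := MvPolynomial.totalDegree_mul (nodePoly n x) (MvPolynomial.X 0 ^ j)
    have h1 := totalDegree_toMv2 0 (wPoly n x)
    rw [wPoly_natDegree, ← nodePoly_eq] at h1
    rw [MvPolynomial.totalDegree_X_pow] at h0 ⊢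
    omega
  · rw [Fpoly_eq _ _ _ _ _ _ (by omega)]
    exact Submodule.sub_mem _ (hG _ (by omega)) (Submodule.smul_mem _ _ (hG _ (by omega)))

theorem Q_subspace_even_and_uniqueness (n m σ δ τ : ℕ) (hm : 1 ≤ m)
    (hn : n = 2*m) (hσ : σ = 2*δ) (hτ : τ ≤ 1)
    (x y : ℕ → ℝ)
    (hx : ∀ j, j < n → x (j+1) < x j)
    (hy : ∀ j, j < n + σ → y (j+1) < y j)
    (a b c d : ℕ → ℝ) (p q : ℕ → Polynomial ℝ)
    (hp0 : p 0 = 1) (hp1 : p 1 = C (a 0) * X + C (b 0))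
    (hprec : ∀ k, 1 ≤ k → k ≤ n - 1 →
      p (k+1) + p (k-1) = (C (a k) * X + C (b k)) * p k)
    (hq0 : q 0 = 1) (hq1 : q 1 = C (c 0) * X + C (d 0))
    (hqrec : ∀ k, 1 ≤ k → k ≤ n + σ - 1 →
      q (k+1) + q (k-1) = (C (c k) * X + C (d k)) * q k)
    (hapos : ∀ k, k ≤ n - 1 → 0 < a k)
    (hcpos : ∀ k, k ≤ n + σ - 1 → 0 < c k)
    (harefl : ∀ k, 1 ≤ k → k ≤ n - 1 → a k = a (n - k) ∧ b k = b (n - k))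
    (hcrefl : ∀ k, 1 ≤ k → k ≤ n + σ - 1 →
      c k = c (n + σ - k) ∧ d k = d (n + σ - k))
    (hpdeg : ∀ j, j ≤ n → (p j).natDegree = j)
    (hqdeg : ∀ k, k ≤ n + σ → (q k).natDegree = k)
    (hxalt : ∀ j r, j ≤ n → r ≤ n →
      (p (n - j)).eval (x r) = (-1)^r * (p j).eval (x r))
    (hyalt : ∀ k u, k ≤ n + σ → u ≤ n + σ →
      (q (n + σ - k)).eval (y u) = (-1)^u * (q k).eval (y u)) :
    (∀ P ∈ Submodule.span ℝ
        (Vgens n δ x ∪ {g | ∃ j < m + τ, g = Fpoly n δ τ p q j}),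
      MvPolynomial.totalDegree P ≤ n + δ) ∧
    (∀ P ∈ Submodule.span ℝ
        (Vgens n δ x ∪ {g | ∃ j < m + τ, g = Fpoly n δ τ p q j}),
      ∀ r u, r ≤ n → u ≤ n + σ → (r + u) % 2 = τ →
        MvPolynomial.eval ![x r, y u] P = 0) ∧
    Module.finrank ℝ (Submodule.span ℝ
        (Vgens n δ x ∪ {g | ∃ j < m + τ, g = Fpoly n δ τ p q j}))
      = δ * (δ + 1) / 2 + m + τ ∧
    -- every bivariate vanishing polynomial of total degree ≤ n + δ lies in Q
    (∀ P : MvPolynomial (Fin 2) ℝ, P.totalDegree ≤ n + δ →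
      (∀ r u, r ≤ n → u ≤ n + σ → (r + u) % 2 = τ →
        MvPolynomial.eval ![x r, y u] P = 0) →
      P ∈ Submodule.span ℝ
        (Vgens n δ x ∪ {g | ∃ j < m + τ, g = Fpoly n δ τ p q j})) ∧
    -- hence Lagrange basis polynomials for S_τ are unique modulo Q
    (∀ L L' : ℕ → ℕ → MvPolynomial (Fin 2) ℝ,
      (∀ s v, s ≤ n → v ≤ n + σ → (s + v) % 2 = τ →
        (L s v).totalDegree ≤ n + δ ∧ (L' s v).totalDegree ≤ n + δ ∧
        (∀ r u, r ≤ n → u ≤ n + σ → (r + u) % 2 = τ →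
          MvPolynomial.eval ![x r, y u] (L s v)
            = (if (r, u) = (s, v) then 1 else 0) ∧
          MvPolynomial.eval ![x r, y u] (L' s v)
            = (if (r, u) = (s, v) then 1 else 0))) →
      ∀ s v, s ≤ n → v ≤ n + σ → (s + v) % 2 = τ →
        L s v - L' s v ∈ Submodule.span ℝ
          (Vgens n δ x ∪ {g | ∃ j < m + τ, g = Fpoly n δ τ p q j})) := by
  subst hσ
  have hker := kernel_mem n m δ τ hn hτ x y p q hx hy hp0 hq0 hpdeg hqdeg hxalt hyalt
  refine ⟨deg_Q n m δ τ hn hm hτ x p q hpdeg hqdeg, ?_,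
    dim_Q n m δ τ hn hm hτ x y p q hx hy hp0 hq0 hpdeg hqdeg, hker, ?_⟩
  · intro P hP r u hr hu hru
    induction hP using Submodule.span_induction with
    | mem g hg =>
      rcases hg with hg | ⟨j, hj, rfl⟩
      · exact eval_Vspan n δ x g (Submodule.subset_span hg) r hr _
      · exact eval_Fpoly n δ τ x y p q hxalt hyalt j (by omega) r u hr hu hru
    | zero => simp
    | add a b _ _ ha hb => simp [ha, hb]
    | smul t a _ ha => simp [MvPolynomial.smul_eval, ha]
  · intro L L' hL s v hs hv hsv
    obtain ⟨h1, h2, h3⟩ := hL s v hs hv hsv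
    refine hker _ ((MvPolynomial.totalDegree_sub _ _).trans (max_le h1 h2)) ?_
    intro r u hr hu hru
    obtain ⟨h4, h5⟩ := h3 r u hr hu hru
    rw [map_sub, h4, h5, sub_self]
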